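/- arXiv:1607.06177 — 2 statements merged into one kernel-verified Lean document; each statement's English description precedes it below -/
import Mathlib

section
/- Let Ω ⊆ 𝒰 be a connected open set whose closure Ω̄ is compact and contained in 𝒰, let (A_k) be a null sequence of diffusion matrices on 𝒰, and suppose there is a uniform anti-Lyapunov function U on Ω with respect to (ℒ_{A_k}), with essential lower bound ρ_m. For each k let μ_k be a Borel probability measure on Ω that is a stationary measure for ℒ_{A_k} on Ω, and suppose μ_k converges weak* (as probability measures on Ω̄) to a Borel probability measure μ on Ω̄. Then the support of μ is contained in {x ∈ Ω : U(x) ≤ ρ_m} ∪ ∂Ω, where ∂Ω is the topological boundary of Ω. -/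
open MeasureTheory Set Filter Topology

noncomputable section

/-- Euclidean `n`-space. -/
abbrev En (n : ℕ) := EuclideanSpace ℝ (Fin n)

/-- The adjoint Fokker–Planck operator
`ℒ_A f(x) = ∑ᵢⱼ aⁱʲ(x) ∂²f/∂xᵢ∂xⱼ(x) + ∑ᵢ Vⁱ(x) ∂f/∂xᵢ(x)`. -/
noncomputable def adjFP {n : ℕ} (A : En n → Matrix (Fin n) (Fin n) ℝ) (V : En n → En n)
    (f : En n → ℝ) (x : En n) : ℝ :=
  (∑ i, ∑ j, A x i j *
      iteratedFDeriv ℝ 2 f x ![EuclideanSpace.single i (1 : ℝ), EuclideanSpace.single j (1 : ℝ)])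
    + fderiv ℝ f x (V x)
/-- A Borel probability measure concentrated on `Ω`. -/
def IsProbOn {n : ℕ} (Ω : Set (En n)) (μ : Measure (En n)) : Prop :=
  IsProbabilityMeasure μ ∧ μ Ωᶜ = 0
/-- `μ` is a stationary measure for `ℒ_A` on `Ω`: it is a Borel probability measure on `Ω`
and `∫_Ω ℒ_A f dμ = 0` for every smooth `f` with compact support contained in `Ω`. -/
def IsStationaryMeasure {n : ℕ} (A : En n → Matrix (Fin n) (Fin n) ℝ) (V : En n → En n)
    (Ω : Set (En n)) (μ : Measure (En n)) : Prop :=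
  IsProbOn Ω μ ∧
  ∀ f : En n → ℝ, ContDiff ℝ (⊤ : ℕ∞) f → HasCompactSupport f → tsupport f ⊆ Ω →
    ∫ x in Ω, adjFP A V f x ∂μ = 0
/-- A null sequence of diffusion matrices on `𝒰`: continuous maps into the symmetric
positive-definite matrices converging to `0` uniformly on every compact subset of `𝒰`. -/
def IsNullSeq {n : ℕ} (𝒰 : Set (En n)) (A : ℕ → En n → Matrix (Fin n) (Fin n) ℝ) : Prop :=
  (∀ k, ContinuousOn (A k) 𝒰) ∧
  (∀ k, ∀ x ∈ 𝒰, (A k x).PosDef) ∧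
  (∀ K : Set (En n), K ⊆ 𝒰 → IsCompact K →
    ∀ ε > 0, ∃ N, ∀ k ≥ N, ∀ x ∈ K, ∀ i j, |A k x i j| ≤ ε)
/-- Weak* convergence `μs → μ` of Borel probability measures on `Ω`: the integrals of every
bounded continuous function on `Ω` converge. -/
def WeakStarLimOn {n : ℕ} (Ω : Set (En n)) (μs : ℕ → Measure (En n))
    (μ : Measure (En n)) : Prop :=
  ∀ f : En n → ℝ, ContinuousOn f Ω → (∃ C, ∀ x ∈ Ω, |f x| ≤ C) →
    Tendsto (fun k => ∫ x in Ω, f x ∂μs k) atTop (𝓝 (∫ x in Ω, f x ∂μ))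
/-- The support of a Borel measure: points all of whose open neighborhoods have
positive measure. -/
def measSupp {n : ℕ} (μ : Measure (En n)) : Set (En n) :=
  {x | ∀ s : Set (En n), IsOpen s → x ∈ s → 0 < μ s}
/-- A compact function on `Ω`: a continuous nonnegative function `U` with
`U x < ρ_M := sup_Ω U` everywhere and compact sublevel sets `{x ∈ Ω | U x ≤ ρ}`
for every `ρ < ρ_M` (the supremum is taken in `EReal`, allowing `ρ_M = ∞`). -/
def IsCompactFunctionOn {n : ℕ} (U : En n → ℝ) (Ω : Set (En n)) : Prop :=
  ContinuousOn U Ω ∧ (∀ x ∈ Ω, 0 ≤ U x) ∧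
  (∀ x ∈ Ω, (U x : EReal) < ⨆ y ∈ Ω, (U y : EReal)) ∧
  (∀ ρ : ℝ, (ρ : EReal) < ⨆ y ∈ Ω, (U y : EReal) → IsCompact {x ∈ Ω | U x ≤ ρ})
/-- `U` is a uniform anti-Lyapunov function on `Ω` with respect to `(ℒ_{A_k})`, with essential
lower bound `ρ_m` and constant `γ`: `U` is a `C²` compact function on `Ω` with `ρ_m ∈ (0, ρ_M)`,
`γ > 0`, and `ℒ_{A_k}U(x) ≥ γ` for every `k` and every `x ∈ Ω` with `U(x) > ρ_m`. -/
def IsUniformAntiLyap {n : ℕ} (A : ℕ → En n → Matrix (Fin n) (Fin n) ℝ) (V : En n → En n)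
    (Ω : Set (En n)) (U : En n → ℝ) (ρm γ : ℝ) : Prop :=
  ContDiffOn ℝ 2 U Ω ∧ IsCompactFunctionOn U Ω ∧
  0 < ρm ∧ ((ρm : EReal) < ⨆ y ∈ Ω, (U y : EReal)) ∧ 0 < γ ∧
  ∀ k, ∀ x ∈ Ω, ρm < U x → γ ≤ adjFP (A k) V U x

open Convolution in
theorem aux_mollify {n : ℕ} (f : En n → ℝ) (hf : ContDiff ℝ 1 f) (hfc : HasCompactSupport f)
    (Ω : Set (En n)) (hΩ : IsOpen Ω) (hs : tsupport f ⊆ Ω) (ε : ℝ) (hε : 0 < ε) :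
    ∃ g : En n → ℝ, ContDiff ℝ (⊤ : ℕ∞) g ∧ HasCompactSupport g ∧ tsupport g ⊆ Ω ∧
      ∀ x, ‖fderiv ℝ g x - fderiv ℝ f x‖ ≤ ε := by
  have hK : IsCompact (tsupport f) := hfc
  obtain ⟨δ, hδ, hδΩ⟩ := hK.exists_cthickening_subset_open hΩ hs
  have hcont : Continuous (fderiv ℝ f) := hf.continuous_fderiv one_ne_zero
  have huc : UniformContinuous (fderiv ℝ f) :=
    (hfc.fderiv (𝕜 := ℝ)).uniformContinuous_of_continuous hcont
  obtain ⟨η, hη, hηf⟩ := Metric.uniformContinuous_iff.1 huc ε hε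
  set r := min δ η with hr
  have hrpos : 0 < r := lt_min hδ hη
  let φ : ContDiffBump (0 : En n) := ⟨r / 2, r, by linarith, by linarith⟩
  let g : En n → ℝ := (φ.normed volume ⋆[ContinuousLinearMap.lsmul ℝ ℝ, volume] f)
  have hsub : Function.support g ⊆ Metric.cthickening δ (tsupport f) := by
    intro x hx
    have := support_convolution_subset_swap (ContinuousLinearMap.lsmul ℝ ℝ) hx
    obtain ⟨a, ha, b, hb, rfl⟩ := this
    rw [φ.support_normed_eq] at hb
    refine Metric.mem_cthickening_of_dist_le _ a _ _ (subset_tsupport _ ha) ?_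
    have : ‖b‖ < r := by simpa using hb
    show dist (a + b) a ≤ δ
    rw [dist_eq_norm, add_sub_cancel_left]
    exact this.le.trans (min_le_left _ _)
  have hts : tsupport g ⊆ Metric.cthickening δ (tsupport f) :=
    closure_minimal hsub Metric.isClosed_cthickening
  refine ⟨g, ?_, ?_, hts.trans hδΩ, ?_⟩
  · exact φ.hasCompactSupport_normed.contDiff_convolution_left _ φ.contDiff_normed
      hf.continuous.locallyIntegrable
  · exact hK.cthickening.of_isClosed_subset (isClosed_tsupport _) hts
  · intro x
    have h1 : HasFDerivAt g _ x := hfc.hasFDerivAt_convolution_right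
      (ContinuousLinearMap.lsmul ℝ ℝ) (f := φ.normed volume) (μ := volume)
      φ.continuous_normed.locallyIntegrable hf x
    rw [h1.fderiv, ← dist_eq_norm]
    have h2 := φ.dist_normed_convolution_le (μ := volume) (g := fderiv ℝ f) (x₀ := x) (ε := ε)
      hcont.aestronglyMeasurable (fun y hy => (hηf (lt_of_lt_of_le hy (min_le_right _ _))).le)
    convert h2 using 2
    rw [convolution_def, convolution_def]
    congr 1

theorem aux_V {n : ℕ} (Ω 𝒰 : Set (En n)) (V : En n → En n) (hV : ContinuousOn V 𝒰)
    (hΩ𝒰 : closure Ω ⊆ 𝒰) (f : En n → ℝ) (hf : ContDiff ℝ 1 f) :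
    ContinuousOn (fun x => fderiv ℝ f x (V x)) (closure Ω) :=
  (hf.continuous_fderiv one_ne_zero).continuousOn.clm_apply (hV.mono hΩ𝒰)

theorem aux_smooth {n : ℕ} (𝒰 Ω : Set (En n))
    (V : En n → En n) (hV : ContinuousOn V 𝒰)
    (hΩopen : IsOpen Ω)
    (hΩcl : IsCompact (closure Ω)) (hΩ𝒰 : closure Ω ⊆ 𝒰)
    (A : ℕ → En n → Matrix (Fin n) (Fin n) ℝ) (hA : IsNullSeq 𝒰 A)
    (μs : ℕ → Measure (En n)) (hμs : ∀ k, IsStationaryMeasure (A k) V Ω (μs k))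
    (μ : Measure (En n))
    (hlim : WeakStarLimOn (closure Ω) μs μ)
    (f : En n → ℝ) (hf : ContDiff ℝ (⊤ : ℕ∞) f) (hfc : HasCompactSupport f)
    (hfs : tsupport f ⊆ Ω) :
    ∫ x in closure Ω, fderiv ℝ f x (V x) ∂μ = 0 := by
  have hf1 : ContDiff ℝ 1 f := hf.of_le (by exact_mod_cast le_top)
  have hf2 : ContDiff ℝ 2 f := contDiff_infty.1 hf 2
  have hVc := aux_V Ω 𝒰 V hV hΩ𝒰 f hf1
  have hD2 : Continuous (iteratedFDeriv ℝ 2 f) := hf2.continuous_iteratedFDeriv le_rfl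
  have hDc : ∀ i j : Fin n, Continuous (fun x => iteratedFDeriv ℝ 2 f x
      ![EuclideanSpace.single i (1 : ℝ), EuclideanSpace.single j (1 : ℝ)]) := fun i j => by
    fun_prop
  have hlim1 := hlim _ hVc (by
    obtain ⟨C, hC⟩ := hΩcl.exists_bound_of_continuousOn hVc
    exact ⟨C, hC⟩)
  refine tendsto_nhds_unique hlim1 ?_
  set S : ℕ → En n → ℝ := fun k x => ∑ i, ∑ j, A k x i j *
      iteratedFDeriv ℝ 2 f x ![EuclideanSpace.single i (1 : ℝ), EuclideanSpace.single j (1 : ℝ)]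
    with hS
  have hSc : ∀ k, ContinuousOn (S k) (closure Ω) := by
    intro k
    refine continuousOn_finsetSum _ fun i _ => continuousOn_finsetSum _ fun j _ => ?_
    refine ContinuousOn.mul ?_ (hDc i j).continuousOn
    exact (continuous_apply_apply i j).comp_continuousOn ((hA.1 k).mono hΩ𝒰)
  have key : ∀ k, ∫ x in closure Ω, fderiv ℝ f x (V x) ∂μs k
      = - ∫ x in closure Ω, S k x ∂μs k := by
    intro k
    obtain ⟨⟨hp, h0⟩, hst⟩ := hμs k
    have hae : (closure Ω : Set (En n)) =ᵐ[μs k] Ω := by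
      refine ae_eq_set.2 ⟨measure_mono_null (fun x hx => hx.2) h0, ?_⟩
      rw [Set.diff_eq_empty.2 subset_closure]; simp
    have h1 := hst f hf hfc hfs
    rw [← setIntegral_congr_set hae] at h1
    have h2 : ∫ x in closure Ω, adjFP (A k) V f x ∂μs k =
        ∫ x in closure Ω, S k x ∂μs k + ∫ x in closure Ω, fderiv ℝ f x (V x) ∂μs k :=
      integral_add ((hSc k).integrableOn_compact hΩcl) (hVc.integrableOn_compact hΩcl)
    linarith
  simp_rw [key]
  rw [← neg_zero]
  apply Tendsto.neg
  choose C hC using fun i j => hΩcl.exists_bound_of_continuousOn (hDc i j).continuousOn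
  set M : ℝ := ∑ i, ∑ j, |C i j| with hM
  have hM0 : 0 ≤ M := Finset.sum_nonneg fun i _ => Finset.sum_nonneg fun j _ => abs_nonneg _
  rw [Metric.tendsto_atTop]
  intro ε hε
  obtain ⟨N, hN⟩ := hA.2.2 (closure Ω) hΩ𝒰 hΩcl (ε / (M + 1)) (by positivity)
  refine ⟨N, fun k hk => ?_⟩
  haveI := (hμs k).1.1
  have hb : ∀ x ∈ closure Ω, ‖S k x‖ ≤ ε / (M + 1) * M := by
    intro x hx
    rw [hM, Finset.mul_sum]
    refine (norm_sum_le _ _).trans (Finset.sum_le_sum fun i _ => ?_)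
    rw [Finset.mul_sum]
    refine (norm_sum_le _ _).trans (Finset.sum_le_sum fun j _ => ?_)
    rw [norm_mul]
    exact mul_le_mul (hN k hk x hx i j) ((hC i j x hx).trans (le_abs_self _))
      (norm_nonneg _) (by positivity)
  have h3 := norm_setIntegral_le_of_norm_le_const (μ := μs k) (measure_lt_top _ _) hb
  rw [dist_zero_right]
  refine h3.trans_lt ?_
  have h4 : (μs k).real (closure Ω) ≤ 1 := measureReal_le_one
  have h5 : ε / (M + 1) * M < ε := by
    rw [div_mul_eq_mul_div, div_lt_iff₀ (by positivity)]; nlinarith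
  have h6 : 0 ≤ ε / (M + 1) * M := by positivity
  nlinarith

theorem aux_C1 {n : ℕ} (𝒰 Ω : Set (En n))
    (V : En n → En n) (hV : ContinuousOn V 𝒰)
    (hΩopen : IsOpen Ω)
    (hΩcl : IsCompact (closure Ω)) (hΩ𝒰 : closure Ω ⊆ 𝒰)
    (μ : Measure (En n)) [IsProbabilityMeasure μ]
    (h : ∀ f : En n → ℝ, ContDiff ℝ (⊤ : ℕ∞) f → HasCompactSupport f → tsupport f ⊆ Ω →
      ∫ x in closure Ω, fderiv ℝ f x (V x) ∂μ = 0)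
    (f : En n → ℝ) (hf : ContDiff ℝ 1 f) (hfc : HasCompactSupport f)
    (hfs : tsupport f ⊆ Ω) :
    ∫ x in closure Ω, fderiv ℝ f x (V x) ∂μ = 0 := by
  obtain ⟨C, hC⟩ := hΩcl.exists_bound_of_continuousOn (hV.mono hΩ𝒰)
  rw [← norm_le_zero_iff]
  refine le_of_forall_pos_le_add fun ε hε => ?_
  rw [zero_add]
  obtain ⟨g, hg, hgc, hgs, hgf⟩ := aux_mollify f hf hfc Ω hΩopen hfs (ε / (|C| + 1)) (by positivity)
  have hg1 : ContDiff ℝ 1 g := hg.of_le (by exact_mod_cast le_top)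
  have h1 := h g hg hgc hgs
  have h2 : ∫ x in closure Ω, (fderiv ℝ g x (V x) - fderiv ℝ f x (V x)) ∂μ =
      ∫ x in closure Ω, fderiv ℝ g x (V x) ∂μ - ∫ x in closure Ω, fderiv ℝ f x (V x) ∂μ :=
    integral_sub ((aux_V Ω 𝒰 V hV hΩ𝒰 g hg1).integrableOn_compact hΩcl)
      ((aux_V Ω 𝒰 V hV hΩ𝒰 f hf).integrableOn_compact hΩcl)
  rw [h1, zero_sub] at h2
  rw [← norm_neg, ← h2]
  have hb : ∀ x ∈ closure Ω, ‖fderiv ℝ g x (V x) - fderiv ℝ f x (V x)‖ ≤ ε / (|C| + 1) * |C| := by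
    intro x hx
    rw [← ContinuousLinearMap.sub_apply]
    refine (ContinuousLinearMap.le_opNorm _ _).trans ?_
    exact mul_le_mul (hgf x) ((hC x hx).trans (le_abs_self _)) (norm_nonneg _) (by positivity)
  have h3 := norm_setIntegral_le_of_norm_le_const (μ := μ) (measure_lt_top _ _) hb
  refine h3.trans ?_
  have h4 : μ.real (closure Ω) ≤ 1 := measureReal_le_one
  have h5 : ε / (|C| + 1) * |C| ≤ ε := by
    rw [div_mul_eq_mul_div, div_le_iff₀ (by positivity)]; nlinarith
  have h6 : 0 ≤ ε / (|C| + 1) * |C| := by positivity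
  nlinarith

theorem aux_VU {n : ℕ} (𝒰 Ω : Set (En n)) (V : En n → En n)
    (hΩ𝒰 : closure Ω ⊆ 𝒰)
    (A : ℕ → En n → Matrix (Fin n) (Fin n) ℝ) (hA : IsNullSeq 𝒰 A)
    (U : En n → ℝ) (ρm γ : ℝ) (hU : IsUniformAntiLyap A V Ω U ρm γ)
    (x : En n) (hx : x ∈ Ω) (hρ : ρm < U x) : γ ≤ fderiv ℝ U x (V x) := by
  have hxU : x ∈ 𝒰 := hΩ𝒰 (subset_closure hx)
  have hA0 : ∀ i j, Tendsto (fun k => A k x i j) atTop (𝓝 0) := by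
    intro i j
    rw [Metric.tendsto_atTop]
    intro ε hε
    obtain ⟨N, hN⟩ := hA.2.2 {x} (by simpa using hxU) isCompact_singleton (ε / 2) (by positivity)
    refine ⟨N, fun k hk => ?_⟩
    have := hN k hk x rfl i j
    rw [dist_zero_right, Real.norm_eq_abs]
    linarith
  have hl : Tendsto (fun k => adjFP (A k) V U x) atTop (𝓝 (fderiv ℝ U x (V x))) := by
    have : Tendsto (fun k => adjFP (A k) V U x) atTop (𝓝 ((∑ i : Fin n, ∑ j : Fin n, 0 *
      iteratedFDeriv ℝ 2 U x ![EuclideanSpace.single i (1 : ℝ), EuclideanSpace.single j (1 : ℝ)])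
        + fderiv ℝ U x (V x))) := by
      unfold adjFP
      exact (tendsto_finsetSum _ fun i _ => tendsto_finsetSum _ fun j _ =>
        (hA0 i j).mul_const _).add_const _
    simpa using this
  exact ge_of_tendsto' hl fun k => hU.2.2.2.2.2 k x hx hρ

theorem aux_phi (a b : ℝ) (hab : a < b) : ∃ φ : ℝ → ℝ, ContDiff ℝ 1 φ ∧ (∀ t, b ≤ t → φ t = 0) ∧
    (∀ t, 0 ≤ deriv φ t) ∧ (∀ t, a < t → t < b → 0 < deriv φ t) ∧ (∀ t, t ≤ a → deriv φ t = 0) := by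
  let θ : ℝ → ℝ := fun t => max 0 ((t - a) * (b - t))
  have hθ : Continuous θ := by fun_prop
  let φ : ℝ → ℝ := fun t => ∫ s in b..t, θ s
  have hd : ∀ t, HasDerivAt φ (θ t) t := fun t => hθ.integral_hasStrictDerivAt b t |>.hasDerivAt
  have hd' : deriv φ = θ := funext fun t => (hd t).deriv
  refine ⟨φ, contDiff_one_iff_deriv.2 ⟨fun t => (hd t).differentiableAt, hd' ▸ hθ⟩, ?_, ?_, ?_, ?_⟩
  · intro t ht
    refine (intervalIntegral.integral_congr (g := fun _ => (0 : ℝ)) ?_).trans (by simp)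
    intro s hs
    rw [uIcc_of_le ht] at hs
    exact max_eq_left (mul_nonpos_of_nonneg_of_nonpos (by linarith [hs.1]) (by linarith [hs.1]))
  · intro t; rw [hd']; exact le_max_left _ _
  · intro t h1 h2; rw [hd']
    exact lt_max_of_lt_right (mul_pos (by linarith) (by linarith))
  · intro t h1; rw [hd']
    exact max_eq_left (mul_nonpos_of_nonpos_of_nonneg (by linarith) (by linarith))

/-- Let `Ω ⊆ 𝒰` be a connected open set with compact closure contained in
`𝒰`, `(A_k)` a null sequence of diffusion matrices admitting a uniform anti-Lyapunov function
`U` on `Ω` with essential lower bound `ρ_m`, and `μ_k` stationary measures for `ℒ_{A_k}` on `Ω`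
converging weak* (as measures on `closure Ω`) to `μ`. Then
`supp μ ⊆ {x ∈ Ω : U(x) ≤ ρ_m} ∪ ∂Ω`. -/
theorem stmt12 {n : ℕ} (hn : 1 ≤ n) (𝒰 Ω : Set (En n))
    (h𝒰open : IsOpen 𝒰) (h𝒰conn : IsConnected 𝒰)
    (V : En n → En n) (hV : ContinuousOn V 𝒰)
    (hΩopen : IsOpen Ω) (hΩconn : IsConnected Ω)
    (hΩcl : IsCompact (closure Ω)) (hΩ𝒰 : closure Ω ⊆ 𝒰)
    (A : ℕ → En n → Matrix (Fin n) (Fin n) ℝ) (hA : IsNullSeq 𝒰 A)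
    (U : En n → ℝ) (ρm γ : ℝ) (hU : IsUniformAntiLyap A V Ω U ρm γ)
    (μs : ℕ → Measure (En n)) (hμs : ∀ k, IsStationaryMeasure (A k) V Ω (μs k))
    (μ : Measure (En n)) (hμ : IsProbOn (closure Ω) μ)
    (hlim : WeakStarLimOn (closure Ω) μs μ) :
    measSupp μ ⊆ {x ∈ Ω | U x ≤ ρm} ∪ frontier Ω := by
  intro x hx
  have hprob : IsProbabilityMeasure μ := hμ.1
  by_cases hxc : x ∈ closure Ω
  swap
  · exact absurd (hx _ isClosed_closure.isOpen_compl hxc) (by simp [hμ.2])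
  by_cases hxΩ : x ∈ Ω
  swap
  · right
    rw [hΩopen.frontier_eq]
    exact ⟨hxc, hxΩ⟩
  left
  refine ⟨hxΩ, ?_⟩
  by_contra! hρ
  obtain ⟨ρ, hρ1, hρ2⟩ := EReal.lt_iff_exists_real_btwn.1 (hU.2.1.2.2.1 x hxΩ)
  have hρ1 : U x < ρ := by exact_mod_cast hρ1
  have hUc : ContinuousOn U Ω := hU.2.1.1
  have hK : IsCompact {x ∈ Ω | U x ≤ ρ} := hU.2.1.2.2.2 ρ hρ2
  obtain ⟨φ, hφ, hφb, hφ0, hφpos, hφa⟩ := aux_phi ρm ρ (hρ.trans hρ1)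
  classical
  set f : En n → ℝ := Ω.indicator (fun x => φ (U x)) with hf
  have hsupp : Function.support f ⊆ {x ∈ Ω | U x ≤ ρ} := by
    intro y hy
    have hyΩ : y ∈ Ω := by
      by_contra h; exact hy (Set.indicator_of_notMem h _)
    refine ⟨hyΩ, ?_⟩
    by_contra! h
    apply hy
    rw [hf, Set.indicator_of_mem hyΩ]
    exact hφb _ h.le
  have hts : tsupport f ⊆ {x ∈ Ω | U x ≤ ρ} := closure_minimal hsupp hK.isClosed
  have heq : ∀ y ∈ Ω, f =ᶠ[𝓝 y] fun x => φ (U x) := by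
    intro y hy
    filter_upwards [hΩopen.mem_nhds hy] with z hz
    exact Set.indicator_of_mem hz _
  have hUat : ∀ y ∈ Ω, ContDiffAt ℝ 2 U y := fun y hy => hU.1.contDiffAt (hΩopen.mem_nhds hy)
  have hfC : ContDiff ℝ 1 f := by
    rw [contDiff_iff_contDiffAt]
    intro y
    by_cases hy : y ∈ Ω
    · refine ContDiffAt.congr_of_eventuallyEq ?_ (heq y hy)
      exact hφ.contDiffAt.comp y ((hUat y hy).of_le (by norm_num))
    · have hy' : y ∉ tsupport f := fun h => hy (hts h).1
      exact (contDiffAt_const (c := (0 : ℝ))).congr_of_eventuallyEq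
        (notMem_tsupport_iff_eventuallyEq.1 hy')
  have hfc : HasCompactSupport f := hK.of_isClosed_subset (isClosed_tsupport _) hts
  have hfs : tsupport f ⊆ Ω := hts.trans fun y hy => hy.1
  have hint := aux_C1 𝒰 Ω V hV hΩopen hΩcl hΩ𝒰 μ
    (aux_smooth 𝒰 Ω V hV hΩopen hΩcl hΩ𝒰 A hA μs hμs μ hlim) f hfC hfc hfs
  have hder : ∀ y ∈ Ω, fderiv ℝ f y (V y) = deriv φ (U y) * fderiv ℝ U y (V y) := by
    intro y hy
    rw [(heq y hy).fderiv_eq]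
    have h1 : HasFDerivAt U (fderiv ℝ U y) y :=
      ((hUat y hy).differentiableAt (by norm_num)).hasFDerivAt
    have h2 : HasDerivAt φ (deriv φ (U y)) (U y) :=
      (hφ.differentiable (by norm_num) _).hasDerivAt
    have h3 := (h2.comp_hasFDerivAt y h1).fderiv
    have h4 : (fun x => φ (U x)) = φ ∘ U := rfl
    rw [h4, h3]
    simp
  have hVU := aux_VU 𝒰 Ω V hΩ𝒰 A hA U ρm γ hU
  have hγ : 0 < γ := hU.2.2.2.2.1
  have hnn : ∀ y, 0 ≤ fderiv ℝ f y (V y) := by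
    intro y
    by_cases hy : y ∈ Ω
    · rw [hder y hy]
      rcases le_or_gt (U y) ρm with h | h
      · rw [hφa _ h, zero_mul]
      · exact mul_nonneg (hφ0 _) (hγ.le.trans (hVU y hy h))
    · have hy' : y ∉ tsupport f := fun h => hy (hts h).1
      rw [(notMem_tsupport_iff_eventuallyEq.1 hy').fderiv_eq]
      simp
  have hae := (integral_eq_zero_iff_of_nonneg (μ := μ.restrict (closure Ω))
    (f := fun y => fderiv ℝ f y (V y)) hnn
    ((aux_V Ω 𝒰 V hV hΩ𝒰 f hfC).integrableOn_compact hΩcl)).1 hint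
  have hW : IsOpen (Ω ∩ U ⁻¹' Ioo ρm ρ) := hUc.isOpen_inter_preimage hΩopen isOpen_Ioo
  have hpos := hx _ hW ⟨hxΩ, hρ, hρ1⟩
  refine hpos.ne' ?_
  have hz : μ.restrict (closure Ω) (Ω ∩ U ⁻¹' Ioo ρm ρ) = 0 := by
    refine measure_mono_null ?_ (ae_iff.1 hae)
    rintro y ⟨hy, h1, h2⟩
    have : 0 < fderiv ℝ f y (V y) := by
      rw [hder y hy]
      exact mul_pos (hφpos _ h1 h2) (hγ.trans_le (hVU y hy h1))
    exact this.ne'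
  rwa [Measure.restrict_eq_self _ (inter_subset_left.trans subset_closure)] at hz

end
end

section
/- Let V be a C¹ vector field on a connected open set 𝒰 ⊆ ℝⁿ admitting a C² compact Lyapunov function on 𝒰 with bounded second partial derivatives (i.e. a C² compact function U_g with bounded second derivatives and constants γ_g > 0, ρ_m with V·∇U_g ≤ −γ_g where U_g > ρ_m). Let x₀ ∈ 𝒰 be a strongly repelling equilibrium: V(x₀) = 0 and there exist a connected open neighborhood W of x₀ with compact closure in 𝒰 and a C² compact function U on W such that the Hessian D²U(x) is positive definite for every x ∈ W, U(x₀) = 0, ∇U(x₀) = 0, U(x) > 0 and V(x)·∇U(x) > 0 for every x ∈ W \ {x₀}. Let (A_k) be a normal null sequence of diffusion matrices on 𝒰 with sup_{x∈𝒰}|A_k(x)| → 0, and for each k let μ_k be a stationary measure for ℒ_{A_k} on 𝒰 that is absolutely continuous with respect to Lebesgue measure. Then every weak* limit μ of a subsequence of (μ_k) satisfies μ(W) = 0. -/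
open MeasureTheory Set Filter Topology

noncomputable section

/-- A normal null sequence of diffusion matrices on `𝒰`: a sequence of continuous maps into
the symmetric positive-definite matrices with `sup_{x∈𝒰}|A_k(x)| → 0` and, for every open set
`Ω` with compact closure in `𝒰`, `sup_k ( sup_{x∈Ω}|A_k(x)| / inf_{x∈Ω} λ_min(A_k(x)) ) < ∞`
(expressed via a uniform lower bound `lam` on the smallest eigenvalue over `Ω`). -/
def IsNormalNullSeq {n : ℕ} (𝒰 : Set (En n))
    (A : ℕ → En n → Matrix (Fin n) (Fin n) ℝ) : Prop :=
  (∀ k, ContinuousOn (A k) 𝒰) ∧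
  (∀ k, ∀ x ∈ 𝒰, (A k x).PosDef) ∧
  (∀ ε > 0, ∃ N, ∀ k ≥ N, ∀ x ∈ 𝒰, ∀ i j, |A k x i j| ≤ ε) ∧
  (∀ Ω : Set (En n), IsOpen Ω → IsCompact (closure Ω) → closure Ω ⊆ 𝒰 →
    ∃ C : ℝ, ∀ k, ∃ lam : ℝ, 0 < lam ∧
      (∀ y ∈ Ω, ∀ v : En n, lam * ∑ i, (v i) ^ 2 ≤ ∑ i, ∑ j, v i * A k y i j * v j) ∧
      (∀ x ∈ Ω, ∀ i j, |A k x i j| ≤ C * lam))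


open scoped Convolution in
lemma aux_uc {n : ℕ} {F : Type*} [NormedAddCommGroup F] [NormedSpace ℝ F] [CompleteSpace F]
    (g : En n → F) (hg : Continuous g)
    (hc : HasCompactSupport g) {ε : ℝ} (hε : 0 < ε) : ∃ δ > 0, ∀ φ : ContDiffBump (0 : En n),
      φ.rOut ≤ δ → ∀ x,
      ‖(φ.normed volume ⋆[ContinuousLinearMap.lsmul ℝ ℝ, volume] g) x - g x‖ ≤ ε := by
  obtain ⟨δ, hδ, h⟩ := Metric.uniformContinuous_iff.1 (hc.uniformContinuous_of_continuous hg) ε hε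
  refine ⟨δ, hδ, fun φ hφ x => ?_⟩
  rw [← dist_eq_norm]
  refine φ.dist_normed_convolution_le hg.aestronglyMeasurable ?_
  intro y hy
  exact (h (lt_of_lt_of_le hy hφ)).le

open scoped Convolution in
lemma aux_moll_fderiv {n : ℕ} {F : Type*} [NormedAddCommGroup F] [NormedSpace ℝ F] [CompleteSpace F]
    (φ : ContDiffBump (0 : En n)) (g : En n → F) (hg : ContDiff ℝ 1 g) (hc : HasCompactSupport g) :
    fderiv ℝ (φ.normed volume ⋆[ContinuousLinearMap.lsmul ℝ ℝ, volume] g) =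
      (φ.normed volume ⋆[ContinuousLinearMap.lsmul ℝ ℝ, volume] (fderiv ℝ g)) := by
  ext1 x
  have h := hc.hasFDerivAt_convolution_right (ContinuousLinearMap.lsmul ℝ ℝ) (μ := volume)
    ((φ.continuous_normed (μ := volume)).locallyIntegrable (μ := volume)) hg x
  rw [h.fderiv]
  rfl

open scoped Convolution in
lemma aux_uc1 {n : ℕ} {F : Type*} [NormedAddCommGroup F] [NormedSpace ℝ F] [CompleteSpace F]
    (g : En n → F) (hg : ContDiff ℝ 1 g)
    (hc : HasCompactSupport g) {ε : ℝ} (hε : 0 < ε) : ∃ δ > 0, ∀ φ : ContDiffBump (0 : En n),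
      φ.rOut ≤ δ → ∀ x,
      ‖fderiv ℝ (φ.normed volume ⋆[ContinuousLinearMap.lsmul ℝ ℝ, volume] g) x - fderiv ℝ g x‖
        ≤ ε := by
  obtain ⟨δ, hδ, h⟩ := aux_uc _ (hg.continuous_fderiv one_ne_zero) (hc.fderiv ℝ) hε
  refine ⟨δ, hδ, fun φ hφ x => ?_⟩
  rw [aux_moll_fderiv φ g hg hc]
  exact h φ hφ x

open scoped Convolution in
lemma aux_moll {n : ℕ} (f : En n → ℝ) (hf : ContDiff ℝ 2 f) (hc : HasCompactSupport f)
    {ε : ℝ} (hε : 0 < ε) :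
    ∃ g : En n → ℝ, ContDiff ℝ (⊤ : ℕ∞) g ∧
      tsupport g ⊆ Metric.cthickening ε (tsupport f) ∧
      (∀ x, ‖fderiv ℝ g x - fderiv ℝ f x‖ ≤ ε) ∧
      (∀ x, ‖fderiv ℝ (fderiv ℝ g) x - fderiv ℝ (fderiv ℝ f) x‖ ≤ ε) := by
  have hf1 : ContDiff ℝ 1 (fderiv ℝ f) := hf.fderiv_right (m := 1) (by norm_num)
  have hc1 : HasCompactSupport (fderiv ℝ f) := hc.fderiv ℝ
  obtain ⟨δ1, hδ1, h1⟩ := aux_uc1 _ (hf.of_le (by norm_num)) hc hε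
  obtain ⟨δ2, hδ2, h2⟩ := aux_uc1 _ hf1 hc1 hε
  obtain ⟨r, hr0, hr⟩ : ∃ r : ℝ, 0 < r ∧ r ≤ ε ∧ r ≤ δ1 ∧ r ≤ δ2 :=
    ⟨min ε (min δ1 δ2), by positivity, by simp, by simp, by simp⟩
  obtain ⟨φ, hφr⟩ : ∃ φ : ContDiffBump (0 : En n), φ.rOut = r :=
    ⟨⟨r / 2, r, by positivity, by linarith⟩, rfl⟩
  refine ⟨φ.normed volume ⋆[ContinuousLinearMap.lsmul ℝ ℝ, volume] f, ?_, ?_, ?_, ?_⟩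
  · exact φ.hasCompactSupport_normed.contDiff_convolution_left _ φ.contDiff_normed
      (hf.continuous.locallyIntegrable)
  · refine closure_minimal ?_ Metric.isClosed_cthickening
    refine (support_convolution_subset (L := ContinuousLinearMap.lsmul ℝ ℝ) (μ := volume)
      (f := φ.normed volume) (g := f)).trans ?_
    rintro z ⟨a, ha, b, hb, rfl⟩
    rw [φ.support_normed_eq, hφr] at ha
    refine Metric.mem_cthickening_of_dist_le _ b _ _ (subset_tsupport f hb) ?_
    have := mem_ball_zero_iff.1 ha
    simp only [dist_eq_norm, add_sub_cancel_right]
    linarith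
  · intro x
    exact h1 φ (hφr.le.trans hr.2.1) x
  · intro x
    rw [aux_moll_fderiv φ f (hf.of_le (by norm_num)) hc]
    exact h2 φ (hφr.le.trans hr.2.2) x

lemma aux_integrable {n : ℕ} {Ω K : Set (En n)} {μ : Measure (En n)} [IsFiniteMeasure μ]
    (hK : IsCompact K) (hKΩ : K ⊆ Ω) {h : En n → ℝ} (hc : ContinuousOn h Ω)
    (h0 : ∀ x ∉ K, h x = 0) : IntegrableOn h Ω μ := by
  have h1 : IntegrableOn h K μ := (hc.mono hKΩ).integrableOn_compact hK
  exact (integrableOn_iff_integrable_of_support_subset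
    (fun x hx => by by_contra hxK; exact hx (h0 x hxK))).1 h1 |>.integrableOn

lemma aux_adj_eq {n : ℕ} (A : En n → Matrix (Fin n) (Fin n) ℝ) (V : En n → En n)
    (f : En n → ℝ) (x : En n) : adjFP A V f x = (∑ i, ∑ j, A x i j *
      fderiv ℝ (fderiv ℝ f) x (EuclideanSpace.single i (1 : ℝ)) (EuclideanSpace.single j (1 : ℝ)))
    + fderiv ℝ f x (V x) := by
  simp [adjFP, iteratedFDeriv_two_apply]

lemma aux_adj_zero {n : ℕ} (A : En n → Matrix (Fin n) (Fin n) ℝ) (V : En n → En n)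
    (f : En n → ℝ) (x : En n) (hx : x ∉ tsupport f) : fderiv ℝ f x = 0 ∧
      fderiv ℝ (fderiv ℝ f) x = 0 ∧ adjFP A V f x = 0 := by
  have h1 : fderiv ℝ f x = 0 := by
    by_contra h; exact hx (tsupport_fderiv_subset ℝ (subset_tsupport _ h))
  have h2 : fderiv ℝ (fderiv ℝ f) x = 0 := by
    by_contra h
    exact hx (tsupport_fderiv_subset ℝ (tsupport_fderiv_subset ℝ (subset_tsupport _ h)))
  refine ⟨h1, h2, ?_⟩
  rw [aux_adj_eq, h1, h2]; simp

lemma aux_A_cont {n : ℕ} {Ω : Set (En n)} {A : En n → Matrix (Fin n) (Fin n) ℝ}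
    (hA : ContinuousOn A Ω) (f : En n → ℝ) (hf : ContDiff ℝ 2 f) :
    ContinuousOn (fun x => ∑ i, ∑ j, A x i j *
      fderiv ℝ (fderiv ℝ f) x (EuclideanSpace.single i (1 : ℝ)) (EuclideanSpace.single j (1 : ℝ)))
      Ω := by
  have hf1 : ContDiff ℝ 1 (fderiv ℝ f) := hf.fderiv_right (m := 1) (by norm_num)
  have hf2 : Continuous (fderiv ℝ (fderiv ℝ f)) := hf1.continuous_fderiv (by norm_num)
  refine continuousOn_finsetSum _ fun i _ => continuousOn_finsetSum _ fun j _ => ?_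
  refine ContinuousOn.mul ?_ ?_
  · exact ((continuous_apply_apply i j).comp_continuousOn hA)
  · exact Continuous.continuousOn (by fun_prop)

lemma aux_V_cont {n : ℕ} {Ω : Set (En n)} {V : En n → En n}
    (hV : ContinuousOn V Ω) (f : En n → ℝ) (hf : ContDiff ℝ 2 f) :
    ContinuousOn (fun x => fderiv ℝ f x (V x)) Ω := by
  have hf1 : ContDiff ℝ 1 (fderiv ℝ f) := hf.fderiv_right (m := 1) (by norm_num)
  exact (hf1.continuous.continuousOn).clm_apply hV

lemma aux_adj_cont {n : ℕ} {Ω : Set (En n)} {A : En n → Matrix (Fin n) (Fin n) ℝ} {V : En n → En n}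
    (hA : ContinuousOn A Ω) (hV : ContinuousOn V Ω) (f : En n → ℝ) (hf : ContDiff ℝ 2 f) :
    ContinuousOn (adjFP A V f) Ω := by
  have : adjFP A V f = fun x => _ := funext fun x => aux_adj_eq A V f x
  rw [this]
  exact (aux_A_cont hA f hf).add (aux_V_cont hV f hf)

lemma aux_sum_bound {n : ℕ} (a : Matrix (Fin n) (Fin n) ℝ) (M : ℝ) (hM : ∀ i j, |a i j| ≤ M)
    (T : En n →L[ℝ] En n →L[ℝ] ℝ) :
    |∑ i, ∑ j, a i j * T (EuclideanSpace.single i (1 : ℝ)) (EuclideanSpace.single j (1 : ℝ))|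
      ≤ (n : ℝ) * n * (M * ‖T‖) := by
  refine (Finset.abs_sum_le_sum_abs _ _).trans ?_
  have : ∀ i ∈ (Finset.univ : Finset (Fin n)), |∑ j, a i j * T (EuclideanSpace.single i (1 : ℝ)) (EuclideanSpace.single j (1 : ℝ))| ≤ n * (M * ‖T‖) := by
    intro i _
    refine (Finset.abs_sum_le_sum_abs _ _).trans ?_
    have : ∀ j ∈ (Finset.univ : Finset (Fin n)), |a i j * T (EuclideanSpace.single i (1 : ℝ)) (EuclideanSpace.single j (1 : ℝ))| ≤ M * ‖T‖ := by
      intro j _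
      rw [abs_mul]
      have h := T.le_opNorm₂ (EuclideanSpace.single i (1 : ℝ)) (EuclideanSpace.single j (1 : ℝ))
      simp only [PiLp.norm_single, norm_one, mul_one, Real.norm_eq_abs] at h
      exact mul_le_mul (hM i j) h (abs_nonneg _) ((abs_nonneg _).trans (hM i j))
    refine (Finset.sum_le_sum this).trans ?_
    simp
  refine (Finset.sum_le_sum this).trans ?_
  simp [mul_assoc]

lemma aux_stat {n : ℕ} {Ω : Set (En n)} (hΩ : IsOpen Ω) {A : En n → Matrix (Fin n) (Fin n) ℝ}
    {V : En n → En n} (hA : ContinuousOn A Ω) (hV : ContinuousOn V Ω) {μ : Measure (En n)}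
    (hμ : IsStationaryMeasure A V Ω μ) (f : En n → ℝ) (hf : ContDiff ℝ 2 f)
    (hc : HasCompactSupport f) (hfΩ : tsupport f ⊆ Ω) :
    ∫ x in Ω, adjFP A V f x ∂μ = 0 := by
  obtain ⟨⟨hp, -⟩, hst⟩ := hμ
  obtain ⟨δ, hδ, hδΩ⟩ := IsCompact.exists_cthickening_subset_open hc hΩ hfΩ
  set K := Metric.cthickening δ (tsupport f) with hK
  have hKc : IsCompact K := IsCompact.cthickening hc
  have hMA : ∀ i j, ∃ M, ∀ x ∈ K, |A x i j| ≤ M := by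
    intro i j
    have : ContinuousOn (fun x => A x i j) K :=
      ((continuous_apply_apply i j).comp_continuousOn hA).mono hδΩ
    obtain ⟨M, hM⟩ := hKc.exists_bound_of_continuousOn this
    exact ⟨M, fun x hx => hM x hx⟩
  choose M0 hM0 using hMA
  obtain ⟨MV, hMV⟩ := hKc.exists_bound_of_continuousOn (hV.mono hδΩ)
  set M := ∑ i, ∑ j, |M0 i j| with hMdef
  have hM : ∀ x ∈ K, ∀ i j, |A x i j| ≤ M := by
    intro x hx i j
    calc |A x i j| ≤ |M0 i j| := (hM0 i j x hx).trans (le_abs_self _)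
      _ ≤ ∑ j, |M0 i j| := Finset.single_le_sum (f := fun j => |M0 i j|) (fun _ _ => abs_nonneg _) (Finset.mem_univ j)
      _ ≤ M := Finset.single_le_sum (f := fun i => ∑ j, |M0 i j|) (fun _ _ => Finset.sum_nonneg fun _ _ => abs_nonneg _) (Finset.mem_univ i)
  have hM0' : 0 ≤ M := Finset.sum_nonneg fun _ _ => Finset.sum_nonneg fun _ _ => abs_nonneg _
  set C := (n : ℝ) * n * M + |MV| with hC
  have hC0 : 0 ≤ C := by positivity
  have key : ∀ ε, 0 < ε → ε ≤ δ → |∫ x in Ω, adjFP A V f x ∂μ| ≤ C * ε := by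
    intro ε hε hεδ
    obtain ⟨g, hg, hgs, hg1, hg2⟩ := aux_moll f hf hc hε
    have hgK : tsupport g ⊆ K := hgs.trans (Metric.cthickening_mono hεδ _)
    have hgc : HasCompactSupport g := hKc.of_isClosed_subset (isClosed_tsupport g) hgK
    have hg0 := hst g hg hgc (hgK.trans hδΩ)
    have hg' : ContDiff ℝ 2 g := contDiff_infty.1 hg 2
    have i1 : IntegrableOn (adjFP A V f) Ω μ := aux_integrable hc hfΩ (aux_adj_cont hA hV f hf)
      (fun x hx => (aux_adj_zero A V f x hx).2.2)
    have i2 : IntegrableOn (adjFP A V g) Ω μ := aux_integrable hgc (hgK.trans hδΩ)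
      (aux_adj_cont hA hV g hg') (fun x hx => (aux_adj_zero A V g x hx).2.2)
    have : ∫ x in Ω, adjFP A V f x ∂μ = - ∫ x in Ω, (adjFP A V g x - adjFP A V f x) ∂μ := by
      rw [integral_sub i2 i1, hg0]; simp
    rw [this, abs_neg]
    have hb : ∀ x, ‖adjFP A V g x - adjFP A V f x‖ ≤ C * ε := by
      intro x
      by_cases hx : x ∈ K
      · have e : adjFP A V g x - adjFP A V f x = (∑ i, ∑ j, A x i j *
          (fderiv ℝ (fderiv ℝ g) x - fderiv ℝ (fderiv ℝ f) x) (EuclideanSpace.single i (1 : ℝ)) (EuclideanSpace.single j (1 : ℝ)))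
          + (fderiv ℝ g x - fderiv ℝ f x) (V x) := by
          rw [aux_adj_eq, aux_adj_eq]
          simp only [sub_apply, mul_sub, Finset.sum_sub_distrib]
          ring
        rw [e, hC, add_mul]
        refine (norm_add_le _ _).trans (add_le_add ?_ ?_)
        · refine (aux_sum_bound _ M (hM x hx) _).trans ?_
          rw [mul_assoc _ M ε]
          gcongr
          exact hg2 x
        · refine (ContinuousLinearMap.le_opNorm _ _).trans ?_
          rw [mul_comm]
          exact mul_le_mul ((hMV x hx).trans (le_abs_self _)) (hg1 x) (norm_nonneg _) (abs_nonneg _)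
      · rw [(aux_adj_zero A V g x (fun h => hx (hgK h))).2.2,
          (aux_adj_zero A V f x (fun h => hx (Metric.self_subset_cthickening _ h))).2.2]
        simp; positivity
    have := norm_setIntegral_le_of_norm_le_const (μ := μ) (s := Ω) (measure_lt_top μ Ω) (fun x _ => hb x)
    refine this.trans ?_
    have : μ.real Ω ≤ 1 := measureReal_le_one
    exact mul_le_of_le_one_right (by positivity) this
  by_contra hne
  have hpos : 0 < |∫ x in Ω, adjFP A V f x ∂μ| := abs_pos.2 hne
  set I := |∫ x in Ω, adjFP A V f x ∂μ|
  have := key (min δ (I / (2 * (C + 1)))) (by positivity) (min_le_left _ _)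
  have h2 : C * min δ (I / (2 * (C + 1))) ≤ (C+1) * (I / (2 * (C + 1))) :=
    mul_le_mul (by linarith) (min_le_right _ _) (by positivity) (by positivity)
  have h3 : (C+1) * (I / (2 * (C + 1))) = I / 2 := by field_simp
  linarith

lemma aux_pos_deriv (m : ℕ) (t : ℝ) :
    HasDerivAt (fun t : ℝ => (max t 0) ^ (m + 2)) ((m + 2 : ℝ) * (max t 0) ^ (m + 1)) t := by
  rcases lt_trichotomy t 0 with h | h | h
  · rw [max_eq_right h.le]
    have : (fun t : ℝ => (max t 0) ^ (m + 2)) =ᶠ[𝓝 t] fun _ => 0 := by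
      filter_upwards [eventually_lt_nhds h] with s hs
      rw [max_eq_right hs.le]; simp
    simpa using (hasDerivAt_const t (0 : ℝ)).congr_of_eventuallyEq this
  · subst h
    rw [max_self]
    have : HasDerivAt (fun t : ℝ => (max t 0) ^ (m + 2)) 0 0 := by
      rw [hasDerivAt_iff_isLittleO]
      simp only [max_self, smul_zero, sub_zero, ne_eq, Nat.add_eq_zero_iff, OfNat.ofNat_ne_zero, and_false, not_false_eq_true, zero_pow]
      have h1 : (fun t : ℝ => (max t 0) ^ (m + 2)) =O[𝓝 0] fun t : ℝ => t ^ (m + 2) := by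
        refine Asymptotics.IsBigO.of_bound 1 (Eventually.of_forall fun s => ?_)
        rw [one_mul, norm_pow, norm_pow]
        gcongr
        rw [Real.norm_eq_abs, Real.norm_eq_abs, abs_of_nonneg (le_max_right s 0)]
        exact max_le (le_abs_self s) (abs_nonneg s)
      refine h1.trans_isLittleO ?_
      simpa using Asymptotics.isLittleO_pow_id (𝕜 := ℝ) (n := m + 2) (by omega)
    simpa using this
  · rw [max_eq_left h.le]
    have : (fun t : ℝ => (max t 0) ^ (m + 2)) =ᶠ[𝓝 t] fun t => t ^ (m + 2) := by
      filter_upwards [eventually_gt_nhds h] with s hs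
      rw [max_eq_left hs.le]
    simpa using (hasDerivAt_pow (m + 2) t).congr_of_eventuallyEq this

lemma aux_q1 (ρ t : ℝ) : HasDerivAt (fun t : ℝ => (max (ρ - t) 0) ^ 3) (-(3 * (max (ρ - t) 0) ^ 2)) t := by
  have h := (aux_pos_deriv 1 (ρ - t)).comp t ((hasDerivAt_id t).const_sub ρ)
  refine h.congr_deriv ?_
  norm_num

lemma aux_q2 (ρ t : ℝ) : HasDerivAt (fun t : ℝ => -(3 * (max (ρ - t) 0) ^ 2)) (6 * max (ρ - t) 0) t := by
  have h := (((aux_pos_deriv 0 (ρ - t)).comp t ((hasDerivAt_id t).const_sub ρ)).const_mul 3).neg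
  refine h.congr_deriv ?_
  norm_num; ring

lemma aux_qC (ρ : ℝ) : ContDiff ℝ 2 (fun t : ℝ => (max (ρ - t) 0) ^ 3) := by
  have d1 : deriv (fun t : ℝ => (max (ρ - t) 0) ^ 3) = fun t => -(3 * (max (ρ - t) 0) ^ 2) :=
    funext fun t => (aux_q1 ρ t).deriv
  have d2 : deriv (fun t : ℝ => -(3 * (max (ρ - t) 0) ^ 2)) = fun t => 6 * max (ρ - t) 0 :=
    funext fun t => (aux_q2 ρ t).deriv
  rw [show (2 : WithTop ℕ∞) = 1 + 1 by norm_num, contDiff_succ_iff_deriv]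
  refine ⟨fun t => (aux_q1 ρ t).differentiableAt, by simp, ?_⟩
  rw [d1, contDiff_one_iff_deriv]
  refine ⟨fun t => (aux_q2 ρ t).differentiableAt, ?_⟩
  rw [d2]; fun_prop

lemma aux_chain {n : ℕ} {W : Set (En n)} (hW : IsOpen W) {U : En n → ℝ} (hU : ContDiffOn ℝ 2 U W)
    (ρ : ℝ) {f : En n → ℝ} (hf : ∀ x ∈ W, f x = (max (ρ - U x) 0) ^ 3) {x : En n} (hx : x ∈ W) :
    fderiv ℝ f x = (-(3 * (max (ρ - U x) 0) ^ 2)) • fderiv ℝ U x ∧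
    ∀ v w, fderiv ℝ (fderiv ℝ f) x v w = 6 * max (ρ - U x) 0 * (fderiv ℝ U x v * fderiv ℝ U x w)
      - 3 * (max (ρ - U x) 0) ^ 2 * fderiv ℝ (fderiv ℝ U) x v w := by
  have hUd : ∀ y ∈ W, HasFDerivAt U (fderiv ℝ U y) y := fun y hy =>
    ((hU.contDiffAt (hW.mem_nhds hy)).differentiableAt (by norm_num)).hasFDerivAt
  have h1 : ∀ y ∈ W, fderiv ℝ f y = (-(3 * (max (ρ - U y) 0) ^ 2)) • fderiv ℝ U y := by
    intro y hy
    have e : f =ᶠ[𝓝 y] fun z => (max (ρ - U z) 0) ^ 3 := by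
      filter_upwards [hW.mem_nhds hy] with z hz using hf z hz
    rw [e.fderiv_eq]
    exact ((aux_q1 ρ (U y)).comp_hasFDerivAt y (hUd y hy)).fderiv
  refine ⟨h1 x hx, fun v w => ?_⟩
  have e : fderiv ℝ f =ᶠ[𝓝 x] fun y => (-(3 * (max (ρ - U y) 0) ^ 2)) • fderiv ℝ U y := by
    filter_upwards [hW.mem_nhds hx] with z hz using h1 z hz
  rw [e.fderiv_eq]
  have hUU : HasFDerivAt (fderiv ℝ U) (fderiv ℝ (fderiv ℝ U) x) x :=
    (((hU.contDiffAt (hW.mem_nhds hx)).fderiv_right (m := 1) (by norm_num)).differentiableAt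
      (by norm_num)).hasFDerivAt
  have := ((aux_q2 ρ (U x)).comp_hasFDerivAt x (hUd x hx)).smul hUU
  have h2 := this.fderiv
  have h3 : (fun y => (-(3 * (max (ρ - U y) 0) ^ 2)) • fderiv ℝ U y) =
    ((fun t => -(3 * max (ρ - t) 0 ^ 2)) ∘ U • fderiv ℝ U) := rfl
  rw [h3, h2]
  simp
  ring

lemma aux_glue_cont {n : ℕ} {W K : Set (En n)} (hW : IsOpen W) (hK : IsClosed K) (hKW : K ⊆ W)
    {h : En n → ℝ} (hc : ContinuousOn h W) (h0 : ∀ x ∈ W, x ∉ K → h x = 0) :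
    Continuous (W.indicator h) := by
  rw [continuous_iff_continuousAt]
  intro x
  by_cases hx : x ∈ W
  · refine (hc.continuousAt (hW.mem_nhds hx)).congr ?_
    filter_upwards [hW.mem_nhds hx] with y hy using (indicator_of_mem hy h).symm
  · refine (continuousAt_const (y := (0 : ℝ))).congr ?_
    filter_upwards [hK.isOpen_compl.mem_nhds (fun hk => hx (hKW hk))] with y hy
    by_cases hyW : y ∈ W
    · rw [indicator_of_mem hyW, h0 y hyW hy]
    · rw [indicator_of_notMem hyW]

lemma aux_glue_diff {n : ℕ} {W K : Set (En n)} (hW : IsOpen W) (hK : IsClosed K) (hKW : K ⊆ W)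
    {h : En n → ℝ} (hc : ContDiffOn ℝ 2 h W) (h0 : ∀ x ∈ W, x ∉ K → h x = 0) :
    ContDiff ℝ 2 (W.indicator h) := by
  rw [contDiff_iff_contDiffAt]
  intro x
  by_cases hx : x ∈ W
  · refine (hc.contDiffAt (hW.mem_nhds hx)).congr_of_eventuallyEq ?_
    filter_upwards [hW.mem_nhds hx] with y hy using (indicator_of_mem hy h)
  · refine (contDiffAt_const (c := (0 : ℝ))).congr_of_eventuallyEq ?_
    filter_upwards [hK.isOpen_compl.mem_nhds (fun hk => hx (hKW hk))] with y hy
    by_cases hyW : y ∈ W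
    · rw [indicator_of_mem hyW, h0 y hyW hy]
    · rw [indicator_of_notMem hyW]

lemma aux_tsupp {n : ℕ} {W K : Set (En n)} (hK : IsClosed K)
    {h : En n → ℝ} (h0 : ∀ x ∈ W, x ∉ K → h x = 0) : tsupport (W.indicator h) ⊆ K := by
  refine closure_minimal (fun x hx => ?_) hK
  by_contra hxK
  refine hx ?_
  by_cases hyW : x ∈ W
  · rw [indicator_of_mem hyW, h0 x hyW hxK]
  · rw [indicator_of_notMem hyW]

lemma aux_trace {n : ℕ} (a : Matrix (Fin n) (Fin n) ℝ) (ha : a.IsHermitian) (lam : ℝ)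
    (hl : ∀ v : En n, lam * ∑ i, (v i) ^ 2 ≤ ∑ i, ∑ j, v i * a i j * v j)
    (T : En n →L[ℝ] En n →L[ℝ] ℝ) (hT : ∀ v, 0 ≤ T v v) :
    lam * ∑ i, T (EuclideanSpace.single i (1 : ℝ)) (EuclideanSpace.single i (1 : ℝ)) ≤
    ∑ i, ∑ j, a i j * T (EuclideanSpace.single i (1 : ℝ)) (EuclideanSpace.single j (1 : ℝ)) := by
  have hps : (a - lam • (1 : Matrix (Fin n) (Fin n) ℝ)).PosSemidef := by
    refine Matrix.PosSemidef.of_dotProduct_mulVec_nonneg ?_ ?_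
    · refine ha.sub ?_
      rw [Matrix.IsHermitian]
      simp
    · intro v
      have := hl (WithLp.toLp 2 v)
      simp only [Matrix.sub_mulVec, Matrix.smul_mulVec, Matrix.one_mulVec, dotProduct_sub,
        dotProduct_smul]
      simp only [dotProduct, Matrix.mulVec, Finset.mul_sum, star_trivial, smul_eq_mul] at *
      simp only [← mul_assoc, pow_two] at *
      linarith
  obtain ⟨m, c, hc⟩ := Matrix.posSemidef_iff_eq_sum_vecMulVec.1 hps
  have key : 0 ≤ ∑ i, ∑ j, (a - lam • (1 : Matrix (Fin n) (Fin n) ℝ)) i j *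
      T (EuclideanSpace.single i (1 : ℝ)) (EuclideanSpace.single j (1 : ℝ)) := by
    have : ∀ v : Fin n → ℝ, ∑ i, ∑ j, v i * v j *
      T (EuclideanSpace.single i (1 : ℝ)) (EuclideanSpace.single j (1 : ℝ)) =
        T (∑ i, v i • EuclideanSpace.single i (1 : ℝ)) (∑ i, v i • EuclideanSpace.single i (1 : ℝ)) := by
      intro v
      simp only [map_sum, map_smul, sum_apply, smul_apply,
        smul_eq_mul, Finset.mul_sum]
      rw [Finset.sum_comm]
      refine Finset.sum_congr rfl fun i _ => Finset.sum_congr rfl fun j _ => ?_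
      ring
    rw [hc]
    simp only [Matrix.sum_apply, Matrix.vecMulVec_apply, star_trivial, Finset.sum_mul]
    have e : ∀ i : Fin n, ∑ j, ∑ k, c k i * c k j * T (EuclideanSpace.single i (1 : ℝ)) (EuclideanSpace.single j (1 : ℝ))
      = ∑ k, ∑ j, c k i * c k j * T (EuclideanSpace.single i (1 : ℝ)) (EuclideanSpace.single j (1 : ℝ)) :=
      fun i => Finset.sum_comm
    simp only [e]
    rw [Finset.sum_comm]
    refine Finset.sum_nonneg fun k _ => ?_
    rw [this]
    exact hT _
  have e2 : ∑ i, ∑ j, (a - lam • (1 : Matrix (Fin n) (Fin n) ℝ)) i j *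
      T (EuclideanSpace.single i (1 : ℝ)) (EuclideanSpace.single j (1 : ℝ)) =
      ∑ i, ∑ j, a i j * T (EuclideanSpace.single i (1 : ℝ)) (EuclideanSpace.single j (1 : ℝ)) -
      lam * ∑ i, T (EuclideanSpace.single i (1 : ℝ)) (EuclideanSpace.single i (1 : ℝ)) := by
    simp only [Matrix.sub_apply, Matrix.smul_apply, sub_mul, Finset.sum_sub_distrib, smul_eq_mul,
      Matrix.one_apply, mul_ite, ite_mul, mul_one, mul_zero, zero_mul, Finset.sum_ite_eq,
      Finset.mem_univ, if_true, Finset.mul_sum]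
  linarith

lemma aux_quad {n : ℕ} (a : Matrix (Fin n) (Fin n) ℝ) (M : ℝ) (hM : ∀ i j, |a i j| ≤ M)
    (L : En n →L[ℝ] ℝ) :
    ∑ i, ∑ j, a i j * (L (EuclideanSpace.single i (1 : ℝ)) * L (EuclideanSpace.single j (1 : ℝ)))
      ≤ (n : ℝ) * n * (M * ‖L‖ ^ 2) := by
  have hb : ∀ i, |L (EuclideanSpace.single i (1 : ℝ))| ≤ ‖L‖ := by
    intro i
    simpa using L.le_opNorm (EuclideanSpace.single i (1 : ℝ))
  have : ∀ i ∈ (Finset.univ : Finset (Fin n)), ∀ j ∈ (Finset.univ : Finset (Fin n)),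
      a i j * (L (EuclideanSpace.single i (1 : ℝ)) * L (EuclideanSpace.single j (1 : ℝ))) ≤ M * ‖L‖ ^ 2 := by
    intro i _ j _
    refine (le_abs_self _).trans ?_
    rw [abs_mul, abs_mul, pow_two]
    exact mul_le_mul (hM i j) (mul_le_mul (hb i) (hb j) (abs_nonneg _) (norm_nonneg _))
      (by positivity) ((abs_nonneg _).trans (hM i j))
  refine (Finset.sum_le_sum fun i hi => Finset.sum_le_sum (this i hi)).trans ?_
  simp [mul_assoc]

/-- **noise instability of strongly repelling equilibria.** Let `V` be a `C¹`
vector field on `𝒰` admitting a `C²` compact Lyapunov function `U_g` with bounded second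
derivatives. Let `x₀` be a strongly repelling equilibrium with isolating neighborhood `W` and
associated compact function `U` (positive definite Hessian, `U(x₀) = 0`, `∇U(x₀) = 0`,
`U > 0` and `V·∇U > 0` on `W \ {x₀}`). Let `(A_k)` be a normal null sequence of diffusion
matrices on `𝒰` and `μ_k` absolutely continuous stationary measures for `ℒ_{A_k}` on `𝒰`.
Then every weak* limit `μ` of a subsequence of `(μ_k)` satisfies `μ(W) = 0`. -/
theorem stmt17 {n : ℕ} (hn : 1 ≤ n) (𝒰 : Set (En n))
    (h𝒰open : IsOpen 𝒰) (h𝒰conn : IsConnected 𝒰)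
    (V : En n → En n) (hV : ContDiffOn ℝ 1 V 𝒰)
    (Ug : En n → ℝ) (hUg : ContDiffOn ℝ 2 Ug 𝒰) (hUgcf : IsCompactFunctionOn Ug 𝒰)
    (hUgbdd : ∃ M, ∀ x ∈ 𝒰, ‖iteratedFDeriv ℝ 2 Ug x‖ ≤ M)
    (ρm γg : ℝ) (hρm : 0 < ρm) (hρmM : (ρm : EReal) < ⨆ y ∈ 𝒰, (Ug y : EReal)) (hγg : 0 < γg)
    (hUgLyap : ∀ x ∈ 𝒰, ρm < Ug x → fderiv ℝ Ug x (V x) ≤ -γg)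
    (x₀ : En n) (hx₀𝒰 : x₀ ∈ 𝒰) (hx₀eq : V x₀ = 0)
    (W : Set (En n)) (hWopen : IsOpen W) (hWconn : IsConnected W) (hx₀W : x₀ ∈ W)
    (hWcl : IsCompact (closure W)) (hW𝒰 : closure W ⊆ 𝒰)
    (U : En n → ℝ) (hU : ContDiffOn ℝ 2 U W) (hUcf : IsCompactFunctionOn U W)
    (hHess : ∀ x ∈ W, ∀ v : En n, v ≠ 0 → 0 < iteratedFDeriv ℝ 2 U x ![v, v])
    (hU0 : U x₀ = 0) (hdU0 : fderiv ℝ U x₀ = 0)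
    (hUpos : ∀ x ∈ W, x ≠ x₀ → 0 < U x ∧ 0 < fderiv ℝ U x (V x))
    (A : ℕ → En n → Matrix (Fin n) (Fin n) ℝ) (hA : IsNormalNullSeq 𝒰 A)
    (μs : ℕ → Measure (En n))
    (hμs : ∀ k, IsStationaryMeasure (A k) V 𝒰 (μs k) ∧ μs k ≪ volume) :
    ∀ μ : Measure (En n), ∀ s : ℕ → ℕ, StrictMono s → IsProbOn 𝒰 μ →
      WeakStarLimOn 𝒰 (fun m => μs (s m)) μ → μ W = 0 := by
  intro μ s hs hμ hlim
  obtain ⟨hAc, hApd, hAnull, hAnorm⟩ := hA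
  obtain ⟨hUc, hUnn, hUlt, hUcpt⟩ := hUcf
  have hVc : ContinuousOn V 𝒰 := hV.continuousOn
  have hpμ : IsProbabilityMeasure μ := hμ.1
  have hW𝒰' : W ⊆ 𝒰 := subset_closure.trans hW𝒰
  obtain ⟨C, hC⟩ := hAnorm W hWopen hWcl hW𝒰
  have hT0 : ∀ x ∈ W, ∀ v, v ≠ 0 → 0 < fderiv ℝ (fderiv ℝ U) x v v := by
    intro x hx v hv
    have := hHess x hx v hv
    rw [iteratedFDeriv_two_apply] at this
    simpa using this
  have hT1 : ∀ x ∈ W, ∀ v, 0 ≤ fderiv ℝ (fderiv ℝ U) x v v := by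
    intro x hx v
    by_cases hv : v = 0
    · simp [hv]
    · exact (hT0 x hx v hv).le
  have hLV : ∀ x ∈ W, 0 ≤ fderiv ℝ U x (V x) := by
    intro x hx
    by_cases h : x = x₀
    · rw [h, hdU0]; simp
    · exact (hUpos x hx h).2.le
  have main : ∀ ρ : ℝ, 0 < ρ → (ρ : EReal) < ⨆ y ∈ W, (U y : EReal) →
      μ {x ∈ W | U x < ρ} = 0 := by
    intro ρ hρ hρM
    set K := {x ∈ W | U x ≤ ρ} with hKdef
    have hK : IsCompact K := hUcpt ρ hρM
    have hKW : K ⊆ W := fun x hx => hx.1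
    have hm0 : ∀ x ∈ W, x ∉ K → max (ρ - U x) 0 = 0 := by
      intro x hx hxK
      refine max_eq_right ?_
      by_contra h
      exact hxK ⟨hx, by linarith⟩
    set f : En n → ℝ := W.indicator (fun x => (max (ρ - U x) 0) ^ 3) with hfdef
    have hf0 : ∀ x ∈ W, x ∉ K → (max (ρ - U x) 0) ^ 3 = 0 := fun x hx hxK => by
      rw [hm0 x hx hxK]; simp
    have hf : ContDiff ℝ 2 f := aux_glue_diff hWopen hK.isClosed hKW
      ((aux_qC ρ).comp_contDiffOn hU) hf0
    have hfs : tsupport f ⊆ K := aux_tsupp hK.isClosed hf0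
    have hfc : HasCompactSupport f := hK.of_isClosed_subset (isClosed_tsupport f) hfs
    have hfW : ∀ x ∈ W, f x = (max (ρ - U x) 0) ^ 3 := fun x hx => indicator_of_mem hx _
    have hK𝒰 : K ⊆ 𝒰 := hKW.trans hW𝒰'
    have hd : ∀ x ∈ W, _ := fun x hx => aux_chain hWopen hU ρ hfW hx
    have hstat : ∀ k, ∫ x in 𝒰, adjFP (A k) V f x ∂(μs k) = 0 := fun k =>
      aux_stat h𝒰open (hAc k) hVc (hμs k).1 f hf hfc (hfs.trans hK𝒰)
    have hprob : ∀ k, IsProbabilityMeasure (μs k) := fun k => (hμs k).1.1.1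
    -- step 1
    have hdV0 : ∀ x ∉ K, fderiv ℝ f x (V x) = 0 := fun x hx => by
      rw [(aux_adj_zero (A 0) V f x (fun h => hx (hfs h))).1]; simp
    have hdVc := aux_V_cont hVc f hf
    have hlim1 : Tendsto (fun k => ∫ x in 𝒰, fderiv ℝ f x (V x) ∂(μs (s k))) atTop
        (𝓝 (∫ x in 𝒰, fderiv ℝ f x (V x) ∂μ)) := by
      refine hlim _ hdVc ?_
      obtain ⟨B, hB⟩ := hK.exists_bound_of_continuousOn (hdVc.mono hK𝒰)
      refine ⟨|B|, fun x _ => ?_⟩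
      by_cases hx : x ∈ K
      · exact (hB x hx).trans (le_abs_self B)
      · rw [hdV0 x hx]; simp
    have hlim2 : Tendsto (fun k => ∫ x in 𝒰, fderiv ℝ f x (V x) ∂(μs (s k))) atTop (𝓝 0) := by
      have hf1 : ContDiff ℝ 1 (fderiv ℝ f) := hf.fderiv_right (m := 1) (by norm_num)
      obtain ⟨B, hB⟩ := (hf1.continuous_fderiv one_ne_zero).bounded_above_of_compact_support
        ((hfc.fderiv ℝ).fderiv ℝ)
      have hB0 : 0 ≤ B := (norm_nonneg _).trans (hB x₀)
      rw [Metric.tendsto_atTop]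
      intro ε hε
      set c := (n : ℝ) * n * B with hc
      have hc0 : 0 ≤ c := by positivity
      obtain ⟨N, hN⟩ := hAnull (ε / (c + 1)) (by positivity)
      refine ⟨N, fun k hk => ?_⟩
      have hk' : N ≤ s k := hk.trans hs.le_apply
      have i1 : IntegrableOn (fun x => fderiv ℝ f x (V x)) 𝒰 (μs (s k)) :=
        aux_integrable hK hK𝒰 hdVc hdV0
      have i2 : IntegrableOn (fun x => ∑ i, ∑ j, A (s k) x i j *
        fderiv ℝ (fderiv ℝ f) x (EuclideanSpace.single i (1 : ℝ))
          (EuclideanSpace.single j (1 : ℝ))) 𝒰 (μs (s k)) := by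
        refine aux_integrable hK hK𝒰 (aux_A_cont (hAc (s k)) f hf) fun x hx => ?_
        rw [(aux_adj_zero (A 0) V f x (fun h => hx (hfs h))).2.1]; simp
      have e := hstat (s k)
      simp only [aux_adj_eq] at e
      rw [integral_add i2 i1] at e
      rw [dist_zero_right, eq_neg_of_add_eq_zero_right e, norm_neg]
      have hb := norm_setIntegral_le_of_norm_le_const (μ := μs (s k)) (s := 𝒰)
        (measure_lt_top _ 𝒰) (C := c * (ε / (c + 1))) (f := fun x => ∑ i, ∑ j, A (s k) x i j *
        fderiv ℝ (fderiv ℝ f) x (EuclideanSpace.single i (1 : ℝ))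
          (EuclideanSpace.single j (1 : ℝ))) (fun x hx => by
          refine (aux_sum_bound _ _ (hN (s k) hk' x hx) _).trans ?_
          rw [hc, mul_assoc _ B, mul_comm B]
          gcongr
          exact hB x)
      refine hb.trans_lt ?_
      refine (mul_le_of_le_one_right (by positivity) measureReal_le_one).trans_lt ?_
      rw [← mul_div_assoc, div_lt_iff₀ (by positivity)]
      nlinarith
    have hzero := tendsto_nhds_unique hlim1 hlim2
    have hneg : 0 ≤ fun x => -fderiv ℝ f x (V x) := by
      intro x
      by_cases hx : x ∈ W
      · simp only [(hd x hx).1, Pi.zero_apply, smul_apply, smul_eq_mul]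
        have := hLV x hx
        have h2 : 0 ≤ 3 * max (ρ - U x) 0 ^ 2 := by positivity
        nlinarith [mul_nonneg h2 this]
      · simp [hdV0 x (fun h => hx (hKW h))]
    have hae : ∀ᵐ x ∂(μ.restrict 𝒰), fderiv ℝ f x (V x) = 0 := by
      have i1 : IntegrableOn (fun x => fderiv ℝ f x (V x)) 𝒰 μ :=
        aux_integrable hK hK𝒰 hdVc hdV0
      have := (integral_eq_zero_iff_of_nonneg hneg i1.neg).1 (by rw [integral_neg, hzero, neg_zero])
      filter_upwards [this] with x hx
      simpa using hx
    have hae2 : ∀ᵐ x ∂(μ.restrict 𝒰), x ∈ W → U x < ρ → x = x₀ := by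
      filter_upwards [hae] with x hx hxW hxρ
      by_contra hne
      rw [(hd x hxW).1, max_eq_left (by linarith)] at hx
      have h1 := (hUpos x hxW hne).2
      have h2 : 0 < 3 * (ρ - U x) ^ 2 := by have : 0 < ρ - U x := by linarith
                                            positivity
      simp only [smul_apply, smul_eq_mul] at hx
      nlinarith [mul_pos h2 h1]
    -- step 2
    set g0 : En n → ℝ := fun x => 3 * (max (ρ - U x) 0) ^ 2 *
      (∑ i, fderiv ℝ (fderiv ℝ U) x (EuclideanSpace.single i (1 : ℝ))
        (EuclideanSpace.single i (1 : ℝ))) -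
      6 * max (ρ - U x) 0 * ((n : ℝ) * n * (C * ‖fderiv ℝ U x‖ ^ 2)) with hg0
    have hg00 : ∀ x ∈ W, x ∉ K → g0 x = 0 := fun x hx hxK => by
      simp only [hg0]; rw [hm0 x hx hxK]; simp
    have hDU : ContinuousOn (fderiv ℝ U) W := hU.continuousOn_fderiv_of_isOpen hWopen (by norm_num)
    have hDDU : ContinuousOn (fderiv ℝ (fderiv ℝ U)) W :=
      (hU.fderiv_of_isOpen hWopen (m := 1) (by norm_num)).continuousOn_fderiv_of_isOpen hWopen
        (by norm_num)
    have hg0c : ContinuousOn g0 W := by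
      have hmc : ContinuousOn (fun x => max (ρ - U x) 0) W :=
        (continuousOn_const.sub hUc).sup continuousOn_const
      refine ContinuousOn.sub ?_ ?_
      · refine (continuousOn_const.mul (hmc.pow 2)).mul ?_
        refine continuousOn_finsetSum _ fun i _ => ?_
        exact (hDDU.clm_apply continuousOn_const).clm_apply continuousOn_const
      · exact (continuousOn_const.mul hmc).mul
          (continuousOn_const.mul (continuousOn_const.mul (hDU.norm.pow 2)))
    have hgc : Continuous (W.indicator g0) := aux_glue_cont hWopen hK.isClosed hKW hg0c hg00
    have hgs : tsupport (W.indicator g0) ⊆ K := aux_tsupp hK.isClosed hg00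
    have hgcs : HasCompactSupport (W.indicator g0) :=
      hK.of_isClosed_subset (isClosed_tsupport _) hgs
    have hgK : ∀ x ∉ K, W.indicator g0 x = 0 := fun x hx => by
      by_contra h; exact hx (hgs (subset_tsupport _ h))
    have hgle : ∀ k, ∫ x in 𝒰, W.indicator g0 x ∂(μs k) ≤ 0 := by
      intro k
      obtain ⟨lam, hlam, hl1, hl2⟩ := hC k
      have i1 : IntegrableOn (fun x => lam * W.indicator g0 x) 𝒰 (μs k) :=
        (aux_integrable hK hK𝒰 hgc.continuousOn hgK).const_mul lam
      have i2 : IntegrableOn (adjFP (A k) V f) 𝒰 (μs k) :=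
        aux_integrable hK hK𝒰 (aux_adj_cont (hAc k) hVc f hf)
          (fun x hx => (aux_adj_zero (A k) V f x (fun h => hx (hfs h))).2.2)
      have hle : ∀ x, lam * W.indicator g0 x ≤ -adjFP (A k) V f x := by
        intro x
        by_cases hx : x ∈ W
        · rw [indicator_of_mem hx, aux_adj_eq, (hd x hx).1]
          simp only [(hd x hx).2, hg0]
          have t1 := aux_trace (A k x) (hApd k x (hW𝒰' hx)).1 lam (hl1 x hx)
            (fderiv ℝ (fderiv ℝ U) x) (hT1 x hx)
          have t2 := aux_quad (A k x) (C * lam) (hl2 x hx) (fderiv ℝ U x)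
          have t3 := hLV x hx
          have hm : 0 ≤ max (ρ - U x) 0 := le_max_right _ _
          generalize max (ρ - U x) 0 = m at hm
          have e : ∑ i, ∑ j, A k x i j * (6 * m * (fderiv ℝ U x (EuclideanSpace.single i (1 : ℝ)) *
              fderiv ℝ U x (EuclideanSpace.single j (1 : ℝ))) - 3 * m ^ 2 *
              fderiv ℝ (fderiv ℝ U) x (EuclideanSpace.single i (1 : ℝ))
                (EuclideanSpace.single j (1 : ℝ))) =
              6 * m * (∑ i, ∑ j, A k x i j * (fderiv ℝ U x (EuclideanSpace.single i (1 : ℝ)) *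
              fderiv ℝ U x (EuclideanSpace.single j (1 : ℝ)))) - 3 * m ^ 2 *
              (∑ i, ∑ j, A k x i j * fderiv ℝ (fderiv ℝ U) x (EuclideanSpace.single i (1 : ℝ))
                (EuclideanSpace.single j (1 : ℝ))) := by
            simp only [Finset.mul_sum, ← Finset.sum_sub_distrib]
            refine Finset.sum_congr rfl fun i _ => Finset.sum_congr rfl fun j _ => ?_
            ring
          rw [e]
          simp only [smul_apply, smul_eq_mul]
          have p1 := mul_le_mul_of_nonneg_left t1 (show 0 ≤ 3 * m ^ 2 by positivity)
          have p2 := mul_le_mul_of_nonneg_left t2 (show 0 ≤ 6 * m by positivity)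
          have p3 := mul_nonneg (show 0 ≤ 3 * m ^ 2 by positivity) t3
          nlinarith [p1, p2, p3]
        · rw [hgK x (fun h => hx (hKW h)),
            (aux_adj_zero (A k) V f x (fun h => hx (hKW (hfs h)))).2.2]; simp
      have h1 : ∫ x in 𝒰, lam * W.indicator g0 x ∂(μs k) ≤ ∫ x in 𝒰, -adjFP (A k) V f x ∂(μs k) :=
        integral_mono i1 i2.neg hle
      rw [integral_neg, hstat k, neg_zero, integral_const_mul] at h1
      by_contra h
      push Not at h
      nlinarith [mul_pos hlam h]
    have hlim3 := hlim (W.indicator g0) hgc.continuousOn (by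
      obtain ⟨B, hB⟩ := hgc.bounded_above_of_compact_support hgcs
      exact ⟨B, fun x _ => hB x⟩)
    have hfin : ∫ x in 𝒰, W.indicator g0 x ∂μ ≤ 0 :=
      le_of_tendsto' hlim3 fun k => hgle (s k)
    have hcongr : ∫ x in 𝒰, W.indicator g0 x ∂μ =
        ∫ x in 𝒰, ({x₀} : Set (En n)).indicator (fun _ => g0 x₀) x ∂μ := by
      refine integral_congr_ae ?_
      filter_upwards [hae2] with x hx
      by_cases h : x = x₀
      · subst h
        rw [indicator_of_mem hx₀W, indicator_of_mem (mem_singleton x)]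
      · rw [indicator_of_notMem (s := {x₀}) (by simpa using h)]
        by_cases hxW : x ∈ W
        · rw [indicator_of_mem hxW]
          have : ¬ U x < ρ := fun h' => h (hx hxW h')
          simp only [hg0]
          rw [max_eq_right (by linarith)]; simp
        · rw [indicator_of_notMem hxW]
    rw [hcongr, integral_indicator_const _ (measurableSet_singleton x₀)] at hfin
    have hgx : 0 < g0 x₀ := by
      simp only [hg0, hdU0, hU0, sub_zero, max_eq_left hρ.le]
      have : 0 < ∑ i, fderiv ℝ (fderiv ℝ U) x₀ (EuclideanSpace.single i (1 : ℝ))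
        (EuclideanSpace.single i (1 : ℝ)) := by
        have : Nonempty (Fin n) := ⟨⟨0, hn⟩⟩
        refine Finset.sum_pos (fun i _ => hT0 x₀ hx₀W _ ?_) Finset.univ_nonempty
        intro h
        have := congrArg norm h
        simp at this
      simp
      positivity
    have hx0 : (μ.restrict 𝒰) {x₀} = 0 := by
      have : (μ.restrict 𝒰).real {x₀} = 0 := by
        refine le_antisymm ?_ measureReal_nonneg
        by_contra h
        push Not at h
        have := mul_pos h hgx
        simp only [smul_eq_mul] at hfin
        linarith
      exact (measureReal_eq_zero_iff).1 this
    have hnull : ∀ᵐ x ∂(μ.restrict 𝒰), x ∉ {x ∈ W | U x < ρ} := by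
      have : ∀ᵐ x ∂(μ.restrict 𝒰), x ≠ x₀ := by
        rw [ae_iff]; simpa using hx0
      filter_upwards [this, hae2] with x h1 h2 h3
      exact h1 (h2 h3.1 h3.2)
    have hS : (μ.restrict 𝒰) {x ∈ W | U x < ρ} = 0 := by
      rw [ae_iff] at hnull
      simpa using hnull
    have hsub : {x ∈ W | U x < ρ} ⊆ 𝒰 := fun x hx => hW𝒰' hx.1
    rwa [Measure.restrict_eq_self _ hsub] at hS
  refine measure_null_of_locally_null W fun x hx => ?_
  obtain ⟨ρ, h1, h2⟩ := EReal.lt_iff_exists_real_btwn.1 (hUlt x hx)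
  have h1' : U x < ρ := by exact_mod_cast h1
  refine ⟨{y ∈ W | U y < ρ}, ?_, main ρ ((hUnn x hx).trans_lt h1') h2⟩
  have : {y ∈ W | U y < ρ} = W ∩ U ⁻¹' (Iio ρ) := rfl
  rw [this]
  exact mem_nhdsWithin_of_mem_nhds ((hUc.isOpen_inter_preimage hWopen isOpen_Iio).mem_nhds ⟨hx, h1'⟩)

end
end
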